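/- Let n ≥ 1, let U ⊆ ℝ^n be open, and let u : [0,∞) × U → ℂ be smooth, satisfying the wave equation ∂ₜ²u(t,x) = Δₓu(t,x) for all t > 0 and x ∈ U, with initial data f = u(0,·) and g = ∂ₜu(0,·). Assume there exist κ, δ > 0 such that for every compact set L ⊆ U, every j ∈ {0,1,2} and every spatial multi-index α with |α| ≤ 2 one has |∂ₜ^j ∂ₓ^α u(t,x)| ≤ κ·e^{−δt} for all t ≥ 0 and x ∈ L. For each integer k ≥ 0 define vₖ(x) = ((−1)^k/k!) ∫₀^∞ t^k u(t,x) dt. Then each vₖ is twice continuously differentiable on U and satisfies the elliptic equations: −Δv₀ = g on U, −Δv₁ = f on U, and −Δvₖ = −v_{k−2} on U for every k ≥ 2. -/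

import Mathlib

open MeasureTheory Set

/-- Partial derivative of `φ : ℝⁿ → ℂ` in the `i`-th coordinate direction. -/
noncomputable def coordDeriv {n : ℕ} (i : Fin n)
    (φ : EuclideanSpace ℝ (Fin n) → ℂ) : EuclideanSpace ℝ (Fin n) → ℂ :=
  fun x => fderiv ℝ φ x (EuclideanSpace.single i 1)

/-- Laplacian of `φ : ℝⁿ → ℂ`, as the sum of the second partial derivatives in the
coordinate directions. -/
noncomputable def coordLaplacian {n : ℕ}
    (φ : EuclideanSpace ℝ (Fin n) → ℂ) : EuclideanSpace ℝ (Fin n) → ℂ :=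
  fun x => ∑ i : Fin n, coordDeriv i (coordDeriv i φ) x

/-- The `k`-th moment `v_k(x) = ((-1)^k/k!) ∫₀^∞ t^k u(t,x) dt` of a time-dependent
function `u`. -/
noncomputable def waveMoment {n : ℕ} (u : ℝ → EuclideanSpace ℝ (Fin n) → ℂ) (k : ℕ) :
    EuclideanSpace ℝ (Fin n) → ℂ :=
  fun x => (((-1 : ℂ) ^ k) / (k.factorial : ℂ)) * ∫ t in Ioi (0 : ℝ), (t : ℂ) ^ k * u t x

section SmoothSlices

variable {n : ℕ} {U : Set (EuclideanSpace ℝ (Fin n))} {w : ℝ → EuclideanSpace ℝ (Fin n) → ℂ}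

lemma hasFDerivAt_slice (hU : IsOpen U)
    (hw : ContDiffOn ℝ (⊤ : ℕ∞) (fun p : ℝ × EuclideanSpace ℝ (Fin n) => w p.1 p.2)
      (Ici 0 ×ˢ U)) {t : ℝ} (ht : 0 ≤ t) {x : EuclideanSpace ℝ (Fin n)} (hx : x ∈ U) :
    HasFDerivAt (w t)
      ((fderivWithin ℝ (fun p : ℝ × EuclideanSpace ℝ (Fin n) => w p.1 p.2) (Ici 0 ×ˢ U)
        (t, x)).comp (ContinuousLinearMap.inr ℝ ℝ (EuclideanSpace ℝ (Fin n)))) x := by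
  have h := ((hw.differentiableOn (by simp)) (t, x) ⟨ht, hx⟩).hasFDerivWithinAt
  have h2 : HasFDerivWithinAt (fun y : EuclideanSpace ℝ (Fin n) => (t, y))
      (ContinuousLinearMap.inr ℝ ℝ (EuclideanSpace ℝ (Fin n))) U x :=
    (hasFDerivAt_prodMk_right t x).hasFDerivWithinAt
  exact (h.comp x h2 fun y hy => ⟨ht, hy⟩).hasFDerivAt (hU.mem_nhds hx)

lemma contDiffOn_time_slice
    (hw : ContDiffOn ℝ (⊤ : ℕ∞) (fun p : ℝ × EuclideanSpace ℝ (Fin n) => w p.1 p.2)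
      (Ici 0 ×ˢ U)) {x : EuclideanSpace ℝ (Fin n)} (hx : x ∈ U) :
    ContDiffOn ℝ (⊤ : ℕ∞) (fun s => w s x) (Ici 0) :=
  hw.comp (f := fun s : ℝ => (s, x)) (by fun_prop) fun s hs => ⟨hs, hx⟩

lemma contDiffOn_coordDeriv (hU : IsOpen U)
    (hw : ContDiffOn ℝ (⊤ : ℕ∞) (fun p : ℝ × EuclideanSpace ℝ (Fin n) => w p.1 p.2)
      (Ici 0 ×ˢ U)) (i : Fin n) :
    ContDiffOn ℝ (⊤ : ℕ∞) (fun p : ℝ × EuclideanSpace ℝ (Fin n) => coordDeriv i (w p.1) p.2)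
      (Ici 0 ×ˢ U) := by
  have hS : UniqueDiffOn ℝ (Ici (0 : ℝ) ×ˢ U) := (uniqueDiffOn_Ici 0).prod hU.uniqueDiffOn
  refine ((hw.fderivWithin hS (m := (⊤ : ℕ∞)) (by simp)).clm_apply
    (contDiffOn_const (c := ((0 : ℝ), EuclideanSpace.single i (1 : ℝ))))).congr ?_
  rintro ⟨t, x⟩ ⟨ht, hx⟩
  simp only [coordDeriv]
  rw [(hasFDerivAt_slice hU hw ht hx).fderiv]
  simp

end SmoothSlices

lemma fderiv_eq_sum_coordDeriv {n : ℕ} (φ : EuclideanSpace ℝ (Fin n) → ℂ)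
    (x : EuclideanSpace ℝ (Fin n)) :
    fderiv ℝ φ x = ∑ i : Fin n,
      (EuclideanSpace.proj i : EuclideanSpace ℝ (Fin n) →L[ℝ] ℝ).smulRight (coordDeriv i φ x) := by
  ext y
  conv_lhs => rw [← (EuclideanSpace.basisFun (Fin n) ℝ).sum_repr y]
  simp [coordDeriv]

lemma norm_fderiv_le_sum_coordDeriv {n : ℕ} (φ : EuclideanSpace ℝ (Fin n) → ℂ)
    (x : EuclideanSpace ℝ (Fin n)) :
    ‖fderiv ℝ φ x‖ ≤ ∑ i : Fin n, ‖coordDeriv i φ x‖ := by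
  refine ContinuousLinearMap.opNorm_le_bound _ (by positivity) fun y => ?_
  rw [fderiv_eq_sum_coordDeriv, Finset.sum_mul, sum_apply]
  refine (norm_sum_le _ _).trans (Finset.sum_le_sum fun i _ => ?_)
  simp only [ContinuousLinearMap.smulRight_apply, PiLp.proj_apply, norm_smul]
  rw [mul_comm]
  gcongr
  exact PiLp.norm_apply_le y i

lemma contDiffOn_succ_of_coordDeriv {n m : ℕ} {U : Set (EuclideanSpace ℝ (Fin n))}
    (hU : IsOpen U) {φ : EuclideanSpace ℝ (Fin n) → ℂ} (hd : DifferentiableOn ℝ φ U)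
    (hφ : ∀ i, ContDiffOn ℝ m (coordDeriv i φ) U) : ContDiffOn ℝ (m + 1) φ U := by
  rw [contDiffOn_succ_iff_fderiv_of_isOpen hU]
  refine ⟨hd, by simp, ?_⟩
  simp only [funext (fderiv_eq_sum_coordDeriv φ)]
  refine ContDiffOn.sum fun i _ => ?_
  exact ((ContinuousLinearMap.smulRightL ℝ (EuclideanSpace ℝ (Fin n)) ℂ
    (EuclideanSpace.proj i)).contDiff (n := m)).comp_contDiffOn (hφ i)

lemma coordDeriv_congr {n : ℕ} {U : Set (EuclideanSpace ℝ (Fin n))} (hU : IsOpen U)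
    {φ ψ : EuclideanSpace ℝ (Fin n) → ℂ} (h : EqOn φ ψ U) (i : Fin n) :
    EqOn (coordDeriv i φ) (coordDeriv i ψ) U := fun x hx => by
  simp only [coordDeriv, (h.eventuallyEq_of_mem (hU.mem_nhds hx)).fderiv_eq]

lemma integrableOn_pow_mul_exp (k : ℕ) {δ : ℝ} (hδ : 0 < δ) (C : ℝ) :
    IntegrableOn (fun t : ℝ => t ^ k * (C * Real.exp (-δ * t))) (Ioi 0) := by
  have h := integrableOn_rpow_mul_exp_neg_mul_rpow (p := 1) (s := k) (b := δ)
    (by have : (0 : ℝ) ≤ k := k.cast_nonneg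
        linarith) one_pos hδ
  simp only [Real.rpow_one, Real.rpow_natCast] at h
  refine (h.const_mul C).congr (ae_of_all _ fun t => ?_)
  simp only
  ring

lemma norm_pow_mul_le {t : ℝ} (ht : 0 ≤ t) (k : ℕ) {z : ℂ} {B : ℝ} (hz : ‖z‖ ≤ B) :
    ‖(t : ℂ) ^ k * z‖ ≤ t ^ k * B := by
  rw [norm_mul, norm_pow, Complex.norm_real, Real.norm_of_nonneg ht]
  gcongr

lemma integrableOn_pow_mul {ψ : ℝ → ℂ} {C δ : ℝ} (hδ : 0 < δ) (hψ : ContinuousOn ψ (Ici 0))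
    (hb : ∀ t, 0 ≤ t → ‖ψ t‖ ≤ C * Real.exp (-δ * t)) (k : ℕ) :
    IntegrableOn (fun t : ℝ => (t : ℂ) ^ k * ψ t) (Ioi 0) := by
  refine (integrableOn_pow_mul_exp k hδ C).mono' ?_ ?_
  · refine ContinuousOn.aestronglyMeasurable ?_ measurableSet_Ioi
    exact ContinuousOn.mul (by fun_prop) (hψ.mono Ioi_subset_Ici_self)
  · exact (ae_restrict_mem measurableSet_Ioi).mono fun t ht =>
      norm_pow_mul_le (le_of_lt ht) k (hb t (le_of_lt ht))

lemma tendsto_pow_mul_zero {ψ : ℝ → ℂ} {C δ : ℝ} (hδ : 0 < δ)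
    (hb : ∀ t, 0 ≤ t → ‖ψ t‖ ≤ C * Real.exp (-δ * t)) (k : ℕ) :
    Filter.Tendsto (fun t : ℝ => (t : ℂ) ^ k * ψ t) Filter.atTop (nhds 0) := by
  have h := ((tendsto_rpow_mul_exp_neg_mul_atTop_nhds_zero k δ hδ).const_mul C)
  simp only [Real.rpow_natCast, mul_zero] at h
  refine squeeze_zero_norm' ?_ h
  filter_upwards [Filter.eventually_ge_atTop 0] with t ht
  refine (norm_pow_mul_le ht k (hb t ht)).trans_eq ?_
  ring

lemma integral_deriv_of_exp_decay {ψ χ : ℝ → ℂ} {C δ : ℝ} (hδ : 0 < δ)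
  (hψ : ContinuousOn ψ (Ici 0)) (hχ : ContinuousOn χ (Ici 0))
  (hderiv : ∀ t, 0 < t → HasDerivAt ψ (χ t) t)
  (hbψ : ∀ t, 0 ≤ t → ‖ψ t‖ ≤ C * Real.exp (-δ * t))
  (hbχ : ∀ t, 0 ≤ t → ‖χ t‖ ≤ C * Real.exp (-δ * t)) :
    ∫ t in Ioi (0 : ℝ), χ t = -ψ 0 := by
  have hi := integrableOn_pow_mul hδ hχ hbχ 0
  have ht := tendsto_pow_mul_zero hδ hbψ 0
  simp only [pow_zero, one_mul] at hi ht
  rw [integral_Ioi_of_hasDerivAt_of_tendsto (hψ 0 self_mem_Ici) hderiv hi ht, zero_sub]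

lemma integral_pow_succ_mul_deriv_of_exp_decay {ψ χ : ℝ → ℂ} {C δ : ℝ} (hδ : 0 < δ)
  (hψ : ContinuousOn ψ (Ici 0)) (hχ : ContinuousOn χ (Ici 0))
  (hderiv : ∀ t, 0 < t → HasDerivAt ψ (χ t) t)
  (hbψ : ∀ t, 0 ≤ t → ‖ψ t‖ ≤ C * Real.exp (-δ * t))
  (hbχ : ∀ t, 0 ≤ t → ‖χ t‖ ≤ C * Real.exp (-δ * t)) (k : ℕ) :
    ∫ t in Ioi (0 : ℝ), (t : ℂ) ^ (k + 1) * χ t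
      = -((k + 1 : ℂ) * ∫ t in Ioi (0 : ℝ), (t : ℂ) ^ k * ψ t) := by
  have hi := integrableOn_pow_mul hδ hχ hbχ (k + 1)
  have hj := (integrableOn_pow_mul hδ hψ hbψ k).const_mul (k + 1 : ℂ)
  have ht := tendsto_pow_mul_zero hδ hbψ (k + 1)
  have hc : ContinuousOn (fun t : ℝ => (t : ℂ) ^ (k + 1) * ψ t) (Ici 0) :=
    ContinuousOn.mul (by fun_prop) hψ
  have hd : ∀ t ∈ Ioi (0 : ℝ), HasDerivAt (fun t : ℝ => (t : ℂ) ^ (k + 1) * ψ t)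
      ((k + 1 : ℂ) * ((t : ℂ) ^ k * ψ t) + (t : ℂ) ^ (k + 1) * χ t) t := fun t ht => by
    have h1 := ((hasDerivAt_id t).ofReal_comp.pow (k + 1)).mul (hderiv t ht)
    refine h1.congr_deriv ?_
    simp
    ring
  have h := integral_Ioi_of_hasDerivAt_of_tendsto (hc 0 self_mem_Ici) hd (hj.add hi) ht
  rw [integral_add hj hi, integral_const_mul] at h
  simp only [Complex.ofReal_zero, ne_eq, Nat.add_eq_zero_iff, one_ne_zero, and_false,
    not_false_eq_true, zero_pow, zero_mul, sub_zero] at h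
  exact eq_neg_of_add_eq_zero_right h

/-- Exponential decay in time, uniform on compact subsets of `U`. -/
def ExpDecayOn {n : ℕ} (U : Set (EuclideanSpace ℝ (Fin n))) (κ δ : ℝ)
    (w : ℝ → EuclideanSpace ℝ (Fin n) → ℂ) : Prop :=
  ∀ L ⊆ U, IsCompact L → ∀ t : ℝ, 0 ≤ t → ∀ x ∈ L, ‖w t x‖ ≤ κ * Real.exp (-δ * t)

lemma ExpDecayOn.bound {n : ℕ} {U : Set (EuclideanSpace ℝ (Fin n))} {κ δ : ℝ}
    {w : ℝ → EuclideanSpace ℝ (Fin n) → ℂ} (h : ExpDecayOn U κ δ w)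
    {x : EuclideanSpace ℝ (Fin n)} (hx : x ∈ U) (t : ℝ) (ht : 0 ≤ t) :
    ‖w t x‖ ≤ κ * Real.exp (-δ * t) :=
  h {x} (by simpa using hx) isCompact_singleton t ht x rfl

section MomentDerivatives

variable {n : ℕ} {U : Set (EuclideanSpace ℝ (Fin n))} {κ δ : ℝ}
  {w : ℝ → EuclideanSpace ℝ (Fin n) → ℂ}

lemma continuousOn_integral_pow_mul (hU : IsOpen U) (hδ : 0 < δ)
    (hw : ContDiffOn ℝ (⊤ : ℕ∞) (fun p : ℝ × EuclideanSpace ℝ (Fin n) => w p.1 p.2)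
      (Ici 0 ×ˢ U)) (hb : ExpDecayOn U κ δ w) (k : ℕ) :
    ContinuousOn (fun x => ∫ t in Ioi (0 : ℝ), (t : ℂ) ^ k * w t x) U := by
  refine continuousOn_of_dominated (bound := fun t => t ^ k * (κ * Real.exp (-δ * t)))
    (fun x hx => ?_) (fun x hx => ?_) (integrableOn_pow_mul_exp k hδ κ) ?_
  · exact (integrableOn_pow_mul hδ (contDiffOn_time_slice hw hx).continuousOn
      (hb.bound hx) k).aestronglyMeasurable
  · exact (ae_restrict_mem measurableSet_Ioi).mono fun t ht =>
      norm_pow_mul_le (le_of_lt ht) k (hb.bound hx t (le_of_lt ht))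
  · refine (ae_restrict_mem measurableSet_Ioi).mono fun t ht x hx => ?_
    exact (continuousAt_const.mul
      (hasFDerivAt_slice hU hw (le_of_lt ht) hx).continuousAt).continuousWithinAt

lemma differentiableAt_and_coordDeriv_integral_pow_mul (hU : IsOpen U) (hδ : 0 < δ)
    (hw : ContDiffOn ℝ (⊤ : ℕ∞) (fun p : ℝ × EuclideanSpace ℝ (Fin n) => w p.1 p.2)
      (Ici 0 ×ˢ U)) (hb : ExpDecayOn U κ δ w)
    (hb1 : ∀ i, ExpDecayOn U κ δ fun t => coordDeriv i (w t)) (k : ℕ)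
    {x : EuclideanSpace ℝ (Fin n)} (hx : x ∈ U) :
    DifferentiableAt ℝ (fun x => ∫ t in Ioi (0 : ℝ), (t : ℂ) ^ k * w t x) x ∧
    ∀ i, coordDeriv i (fun x => ∫ t in Ioi (0 : ℝ), (t : ℂ) ^ k * w t x) x
      = ∫ t in Ioi (0 : ℝ), (t : ℂ) ^ k * coordDeriv i (w t) x := by
  obtain ⟨r, hr, hrU⟩ := Metric.nhds_basis_closedBall.mem_iff.1 (hU.mem_nhds hx)
  have hc : ContinuousOn (fun t => fderiv ℝ (w t) x) (Ici 0) := by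
    simp only [fun t => fderiv_eq_sum_coordDeriv (w t) x]
    refine continuousOn_finsetSum _ fun i _ => ?_
    exact (ContinuousLinearMap.smulRightL ℝ (EuclideanSpace ℝ (Fin n)) ℂ
      (EuclideanSpace.proj i)).continuous.comp_continuousOn
        (contDiffOn_time_slice (contDiffOn_coordDeriv hU hw i) hx).continuousOn
  have hint : IntegrableOn (fun t : ℝ => t ^ k * (n * κ * Real.exp (-δ * t))) (Ioi 0) :=
    integrableOn_pow_mul_exp k hδ _
  have hbd : ∀ t ∈ Ioi (0 : ℝ), ∀ y ∈ Metric.ball x r,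
      ‖(t : ℂ) ^ k • fderiv ℝ (w t) y‖ ≤ t ^ k * (n * κ * Real.exp (-δ * t)) := by
    intro t ht y hy
    have ht0 : 0 ≤ t := le_of_lt ht
    rw [norm_smul, norm_pow, Complex.norm_real, Real.norm_of_nonneg ht0]
    gcongr
    refine (norm_fderiv_le_sum_coordDeriv _ _).trans ?_
    refine (Finset.sum_le_card_nsmul _ _ (κ * Real.exp (-δ * t)) fun i _ =>
      hb1 i _ hrU (isCompact_closedBall x r) t ht0 y (Metric.ball_subset_closedBall hy)).trans_eq ?_
    simp
    ring
  have hmeas : AEStronglyMeasurable (fun t : ℝ => (t : ℂ) ^ k • fderiv ℝ (w t) x)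
      (volume.restrict (Ioi 0)) := by
    refine ContinuousOn.aestronglyMeasurable ?_ measurableSet_Ioi
    exact ContinuousOn.smul (f := fun t : ℝ => (t : ℂ) ^ k) (by fun_prop)
      (hc.mono Ioi_subset_Ici_self)
  have hmain : HasFDerivAt (fun x => ∫ t in Ioi (0 : ℝ), (t : ℂ) ^ k * w t x)
      (∫ t in Ioi (0 : ℝ), (t : ℂ) ^ k • fderiv ℝ (w t) x) x := by
    refine hasFDerivAt_integral_of_dominated_of_fderiv_le (Metric.ball_mem_nhds x hr)
      (F' := fun y (t : ℝ) => (t : ℂ) ^ k • fderiv ℝ (w t) y)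
      ?_ (integrableOn_pow_mul hδ (contDiffOn_time_slice hw hx).continuousOn
        (hb.bound hx) k) hmeas
      ((ae_restrict_mem measurableSet_Ioi).mono hbd) hint ?_
    · filter_upwards [hU.mem_nhds hx] with y hy
      exact (integrableOn_pow_mul hδ (contDiffOn_time_slice hw hy).continuousOn
        (hb.bound hy) k).aestronglyMeasurable
    · refine (ae_restrict_mem measurableSet_Ioi).mono fun t ht y hy => ?_
      exact (hasFDerivAt_slice hU hw (le_of_lt ht)
        (hrU (Metric.ball_subset_closedBall hy))).differentiableAt.hasFDerivAt.const_mul _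
  refine ⟨hmain.differentiableAt, fun i => ?_⟩
  have hI : IntegrableOn (fun t : ℝ => (t : ℂ) ^ k • fderiv ℝ (w t) x) (Ioi 0) :=
    hint.mono' hmeas ((ae_restrict_mem measurableSet_Ioi).mono fun t ht =>
      hbd t ht x (Metric.mem_ball_self hr))
  rw [coordDeriv, hmain.fderiv, ContinuousLinearMap.integral_apply hI]
  rfl

end MomentDerivatives

lemma coordDeriv_const_mul {n : ℕ} (c : ℂ) (i : Fin n) (φ : EuclideanSpace ℝ (Fin n) → ℂ)
    (x : EuclideanSpace ℝ (Fin n)) :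
    coordDeriv i (fun y => c * φ y) x = c * coordDeriv i φ x := by
  simp only [coordDeriv]
  rw [show (fun y => c * φ y) = c • φ from rfl, fderiv_const_smul_field]
  rfl

/-- If `u` is a smooth solution of the wave equation `∂ₜ²u = Δₓu` on `(0,∞) × U` with
initial data `f = u(0,·)`, `g = ∂ₜu(0,·)`, all of whose space-time derivatives of order
`≤ 2` in time and `≤ 2` in space decay like `κ e^{-δt}` uniformly on compact subsets of
`U`, then the moments `vₖ(x) = ((-1)^k/k!) ∫₀^∞ t^k u(t,x) dt` are `C²` on `U` and satisfy
`-Δv₀ = g`, `-Δv₁ = f` and `-Δvₖ = -v_{k-2}` for `k ≥ 2` on `U`. -/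
theorem moments_satisfy_elliptic_equations
    (n : ℕ) (hn : 1 ≤ n) (U : Set (EuclideanSpace ℝ (Fin n))) (hU : IsOpen U)
    (u : ℝ → EuclideanSpace ℝ (Fin n) → ℂ) (κ δ : ℝ) (hκ : 0 < κ) (hδ : 0 < δ)
    (hsmooth : ContDiffOn ℝ (⊤ : ℕ∞)
      (fun p : ℝ × EuclideanSpace ℝ (Fin n) => u p.1 p.2) (Ici 0 ×ˢ U))
    (hwave : ∀ t : ℝ, 0 < t → ∀ x ∈ U,
      deriv (deriv (fun s : ℝ => u s x)) t = coordLaplacian (u t) x)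
    (hdecay : ∀ L : Set (EuclideanSpace ℝ (Fin n)), L ⊆ U → IsCompact L →
      ∀ j : ℕ, j ≤ 2 → ∀ ds : List (Fin n), ds.length ≤ 2 →
      ∀ t : ℝ, 0 ≤ t → ∀ x ∈ L,
      ‖(fun φ : ℝ → ℂ => derivWithin φ (Ici 0))^[j]
          (fun s : ℝ => ds.foldr coordDeriv (u s) x) t‖ ≤ κ * Real.exp (-δ * t)) :
    (∀ k : ℕ, ContDiffOn ℝ 2 (waveMoment u k) U) ∧
    (∀ x ∈ U, -coordLaplacian (waveMoment u 0) x
        = derivWithin (fun s : ℝ => u s x) (Ici 0) 0) ∧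
    (∀ x ∈ U, -coordLaplacian (waveMoment u 1) x = u 0 x) ∧
    (∀ k : ℕ, 2 ≤ k → ∀ x ∈ U,
      -coordLaplacian (waveMoment u k) x = -waveMoment u (k - 2) x) := by
  have hw1 := fun i => contDiffOn_coordDeriv hU hsmooth i
  have hw2 := fun i j =>
    contDiffOn_coordDeriv (w := fun t => coordDeriv i (u t)) hU (hw1 i) j
  have hd0 : ExpDecayOn U κ δ u := fun L hL hc t ht x hx =>
    hdecay L hL hc 0 (by norm_num) [] (by simp) t ht x hx
  have hd1 : ∀ i, ExpDecayOn U κ δ fun t => coordDeriv i (u t) := fun i L hL hc t ht x hx =>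
    hdecay L hL hc 0 (by norm_num) [i] (by simp) t ht x hx
  have hd2 : ∀ i j, ExpDecayOn U κ δ fun t => coordDeriv j (coordDeriv i (u t)) :=
    fun i j L hL hc t ht x hx => hdecay L hL hc 0 (by norm_num) [j, i] (by simp) t ht x hx
  have hD1 := fun (k : ℕ) (x) (hx : x ∈ U) =>
    differentiableAt_and_coordDeriv_integral_pow_mul hU hδ hsmooth hd0 hd1 k hx
  have hD2 := fun (k : ℕ) (i : Fin n) (x) (hx : x ∈ U) =>
    differentiableAt_and_coordDeriv_integral_pow_mul hU hδ (hw1 i) (hd1 i) (hd2 i) k hx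
  have hsecond : ∀ (k : ℕ) (i j : Fin n), ∀ x ∈ U,
      coordDeriv j (coordDeriv i fun x => ∫ t in Ioi (0 : ℝ), (t : ℂ) ^ k * u t x) x
        = ∫ t in Ioi (0 : ℝ), (t : ℂ) ^ k * coordDeriv j (coordDeriv i (u t)) x :=
    fun k i j x hx => (coordDeriv_congr hU (fun y hy => (hD1 k y hy).2 i) j hx).trans
      ((hD2 k i x hx).2 j)
  have hC2 : ∀ k : ℕ, ContDiffOn ℝ 2
      (fun x => ∫ t in Ioi (0 : ℝ), (t : ℂ) ^ k * u t x) U := by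
    intro k
    refine contDiffOn_succ_of_coordDeriv (m := 1) hU
      (fun x hx => (hD1 k x hx).1.differentiableWithinAt) fun i => ?_
    refine ContDiffOn.congr ?_ fun x hx => (hD1 k x hx).2 i
    refine contDiffOn_succ_of_coordDeriv (m := 0) hU
      (fun x hx => (hD2 k i x hx).1.differentiableWithinAt) fun j => ?_
    refine ContDiffOn.congr ?_ fun x hx => (hD2 k i x hx).2 j
    exact contDiffOn_zero.2 (continuousOn_integral_pow_mul hU hδ (hw2 i j) (hd2 i j) k)
  have hlap : ∀ k : ℕ, ∀ x ∈ U, coordLaplacian (waveMoment u k) x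
      = (((-1 : ℂ) ^ k) / (k.factorial : ℂ)) * ∫ t in Ioi (0 : ℝ), (t : ℂ) ^ k *
        derivWithin (derivWithin (fun s : ℝ => u s x) (Ici 0)) (Ici 0) t := by
    intro k x hx
    have hmom : ∀ i : Fin n, coordDeriv i (coordDeriv i (waveMoment u k)) x
        = (((-1 : ℂ) ^ k) / (k.factorial : ℂ)) *
          ∫ t in Ioi (0 : ℝ), (t : ℂ) ^ k * coordDeriv i (coordDeriv i (u t)) x := by
      intro i
      rw [← hsecond k i i x hx, ← coordDeriv_const_mul]
      unfold waveMoment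
      simp only [funext (coordDeriv_const_mul _ _ _)]
    simp only [coordLaplacian, hmom]
    rw [← Finset.mul_sum, ← integral_finsetSum _ fun i _ => integrableOn_pow_mul hδ
      (contDiffOn_time_slice (hw2 i i) hx).continuousOn ((hd2 i i).bound hx) k]
    congr 1
    refine setIntegral_congr_fun measurableSet_Ioi fun t ht => ?_
    rw [← Finset.mul_sum]
    congr 1
    have hev : derivWithin (fun s : ℝ => u s x) (Ici 0) =ᶠ[nhds t] deriv fun s : ℝ => u s x := by
      filter_upwards [Ioi_mem_nhds ht] with s hs
      exact derivWithin_of_mem_nhds (Ici_mem_nhds hs)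
    rw [derivWithin_of_mem_nhds (Ici_mem_nhds ht), hev.deriv_eq]
    exact (hwave t ht x hx).symm
  have hparts : ∀ x ∈ U,
      (∫ t in Ioi (0 : ℝ), derivWithin (derivWithin (fun s : ℝ => u s x) (Ici 0)) (Ici 0) t
        = -derivWithin (fun s : ℝ => u s x) (Ici 0) 0) ∧
      (∫ t in Ioi (0 : ℝ), derivWithin (fun s : ℝ => u s x) (Ici 0) t = -u 0 x) ∧
      (∀ k : ℕ, ∫ t in Ioi (0 : ℝ), (t : ℂ) ^ (k + 1) *
          derivWithin (derivWithin (fun s : ℝ => u s x) (Ici 0)) (Ici 0) t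
        = -((k + 1 : ℂ) * ∫ t in Ioi (0 : ℝ), (t : ℂ) ^ k *
          derivWithin (fun s : ℝ => u s x) (Ici 0) t)) ∧
      (∀ k : ℕ, ∫ t in Ioi (0 : ℝ), (t : ℂ) ^ (k + 1) * derivWithin (fun s : ℝ => u s x) (Ici 0) t
        = -((k + 1 : ℂ) * ∫ t in Ioi (0 : ℝ), (t : ℂ) ^ k * u t x)) := by
    intro x hx
    have hs0 := contDiffOn_time_slice hsmooth hx
    have hs1 := hs0.derivWithin (m := (⊤ : ℕ∞)) (uniqueDiffOn_Ici 0) (by simp)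
    have hs2 := hs1.derivWithin (m := (⊤ : ℕ∞)) (uniqueDiffOn_Ici 0) (by simp)
    have hderiv : ∀ φ : ℝ → ℂ, ContDiffOn ℝ (⊤ : ℕ∞) φ (Ici 0) →
        ∀ t, 0 < t → HasDerivAt φ (derivWithin φ (Ici 0) t) t := fun φ hφ t ht =>
      ((hφ.differentiableOn (by simp)) t ht.le).hasDerivWithinAt.hasDerivAt (Ici_mem_nhds ht)
    have hxL : ({x} : Set (EuclideanSpace ℝ (Fin n))) ⊆ U := by simpa using hx
    have hb0 := hd0.bound hx
    have hb1 : ∀ t, 0 ≤ t → ‖derivWithin (fun s : ℝ => u s x) (Ici 0) t‖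
        ≤ κ * Real.exp (-δ * t) := fun t ht =>
      hdecay {x} hxL isCompact_singleton 1 (by norm_num) [] (by simp) t ht x rfl
    have hb2 : ∀ t, 0 ≤ t → ‖derivWithin (derivWithin (fun s : ℝ => u s x) (Ici 0)) (Ici 0) t‖
        ≤ κ * Real.exp (-δ * t) := fun t ht =>
      hdecay {x} hxL isCompact_singleton 2 le_rfl [] (by simp) t ht x rfl
    exact ⟨integral_deriv_of_exp_decay hδ hs1.continuousOn hs2.continuousOn (hderiv _ hs1) hb1 hb2,
      integral_deriv_of_exp_decay hδ hs0.continuousOn hs1.continuousOn (hderiv _ hs0) hb0 hb1,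
      integral_pow_succ_mul_deriv_of_exp_decay hδ hs1.continuousOn hs2.continuousOn
        (hderiv _ hs1) hb1 hb2,
      integral_pow_succ_mul_deriv_of_exp_decay hδ hs0.continuousOn hs1.continuousOn
        (hderiv _ hs0) hb0 hb1⟩
  refine ⟨fun k => contDiffOn_const.mul (hC2 k), fun x hx => ?_, fun x hx => ?_,
    fun k hk x hx => ?_⟩
  · rw [hlap 0 x hx]
    simp [(hparts x hx).1]
  · have h := (hparts x hx).2.2.1 0
    simp only [pow_zero, one_mul, (hparts x hx).2.1] at h
    rw [hlap 1 x hx, h]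
    simp
  · obtain ⟨m, rfl⟩ := Nat.exists_eq_add_of_le' hk
    rw [hlap (m + 2) x hx, (hparts x hx).2.2.1 (m + 1), (hparts x hx).2.2.2 m]
    simp only [waveMoment, Nat.add_sub_cancel, Nat.factorial_succ, pow_succ]
    have h1 : ((m : ℂ) + 1) ≠ 0 := by exact_mod_cast m.succ_ne_zero
    have h2 : ((m : ℂ) + 1 + 1) ≠ 0 := by exact_mod_cast (m + 1).succ_ne_zero
    have h3 : (m.factorial : ℂ) ≠ 0 := by exact_mod_cast m.factorial_ne_zero
    push_cast
    field_simp
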